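/- arXiv:2604.07905 — 2 statements merged into one kernel-verified Lean document; each statement's English description precedes it below -/
import Mathlib

section
/- Let γ : I → ℝ² be a regular plane curve parametrized by arc length with curvature κ, with Frenet frame (t, n), and suppose v = n and w̄ = n̄ (i.e. θ(s) = τ(s) = π/2 for all s). Then γ is an (n, n̄)-Bertrand regular curve if and only if there exists a nonzero constant λ realizing the mate with 1 − λκ(s) ≠ 0 for all s ∈ I; in this case the mate γ̄ = γ + λ n is a parallel curve of γ. -/
open Real

noncomputable section

/-- Euclidean dot product on the plane `ℝ × ℝ`. -/
def dot (a b : ℝ × ℝ) : ℝ := a.1 * b.1 + a.2 * b.2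

/-- `J`, the anticlockwise rotation by `π/2` on the plane: `J(a₁,a₂) = (−a₂,a₁)`. -/
def Jrot (a : ℝ × ℝ) : ℝ × ℝ := (-a.2, a.1)

/-- `λ ≢ 0` on `I`: the set `{t ∈ I | λ t ≠ 0}` is dense in `I`. -/
def NotIdentZero (I : Set ℝ) (lam : ℝ → ℝ) : Prop :=
  I ⊆ closure {t | t ∈ I ∧ lam t ≠ 0}

/-- The unit tangent `γ̇/|γ̇|` of a plane curve (Euclidean norm). -/
def utang (γ : ℝ → ℝ × ℝ) (s : ℝ) : ℝ × ℝ :=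
  (Real.sqrt (dot (deriv γ s) (deriv γ s)))⁻¹ • deriv γ s

/-- `γ̄` is a regular mate of `γ` in direction `v` with function `λ`:
`γ̄` is smooth and regular on `I`, `λ` is smooth with `λ ≢ 0`, and
`γ̄(s) = γ(s) + λ(s)v(s)` on `I`. -/
def RegularMates (I : Set ℝ) (γ γb v : ℝ → ℝ × ℝ) (lam : ℝ → ℝ) : Prop :=
  ContDiff ℝ (⊤ : ℕ∞) γb ∧ ContDiff ℝ (⊤ : ℕ∞) lam ∧
  (∀ s ∈ I, deriv γb s ≠ 0) ∧
  NotIdentZero I lam ∧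
  (∀ s ∈ I, γb s = γ s + lam s • v s)

theorem HasDerivAt.jrot {f : ℝ → ℝ × ℝ} {f' : ℝ × ℝ} {s : ℝ} (h : HasDerivAt f f' s) :
    HasDerivAt (fun x => Jrot (f x)) (Jrot f') s := by
  have h1 : HasDerivAt (fun x => (f x).1) f'.1 s := by simpa using h.hasFDerivAt.fst.hasDerivAt
  have h2 : HasDerivAt (fun x => (f x).2) f'.2 s := by simpa using h.hasFDerivAt.snd.hasDerivAt
  exact h2.neg.prodMk h1

theorem HasDerivAt.dot_self {f : ℝ → ℝ × ℝ} {f' : ℝ × ℝ} {s : ℝ} (h : HasDerivAt f f' s) :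
    HasDerivAt (fun x => dot (f x) (f x)) (2 * dot f' (f s)) s := by
  have h1 : HasDerivAt (fun x => (f x).1) f'.1 s := by simpa using h.hasFDerivAt.fst.hasDerivAt
  have h2 : HasDerivAt (fun x => (f x).2) f'.2 s := by simpa using h.hasFDerivAt.snd.hasDerivAt
  refine ((h1.mul h1).add (h2.mul h2)).congr_deriv ?_
  simp only [dot]
  ring

theorem Jrot_injective : Function.Injective Jrot := by
  rintro ⟨a, b⟩ ⟨c, d⟩ h
  simp only [Jrot, Prod.mk.injEq, neg_inj] at h ⊢
  exact h.symm

theorem notIdentZero_const (I : Set ℝ) {c : ℝ} (hc : c ≠ 0) :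
    NotIdentZero I fun _ => c := by
  intro s hs
  exact subset_closure ⟨hs, hc⟩

theorem NotIdentZero.exists_ne_zero {I : Set ℝ} {lam : ℝ → ℝ} (h : NotIdentZero I lam)
    (hI : I.Nonempty) : ∃ s ∈ I, lam s ≠ 0 := by
  obtain ⟨s, hs⟩ := hI
  exact closure_nonempty_iff.1 ⟨s, h hs⟩

theorem exists_ne_zero_one_sub_mul_ne_zero (k : ℝ) : ∃ c : ℝ, c ≠ 0 ∧ 1 - c * k ≠ 0 := by
  by_cases hk : k = 1
  · exact ⟨2, by norm_num, by norm_num [hk]⟩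
  · exact ⟨1, one_ne_zero, by rwa [one_mul, sub_ne_zero, ne_comm]⟩

/-- A curve whose unit tangent is `a` has velocity a multiple of `a`. -/
theorem exists_deriv_eq_smul_of_utang_eq {γ : ℝ → ℝ × ℝ} {s : ℝ} {a : ℝ × ℝ}
    (h : a = utang γ s) (ha : a ≠ 0) : ∃ r : ℝ, deriv γ s = r • a := by
  have hr : (Real.sqrt (dot (deriv γ s) (deriv γ s)))⁻¹ ≠ 0 := by
    intro hr
    exact ha (by rw [h, utang, hr, zero_smul])
  exact ⟨Real.sqrt (dot (deriv γ s) (deriv γ s)), by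
    rw [h, utang, smul_smul, mul_inv_cancel₀ (fun h0 => hr (by rw [h0, inv_zero])), one_smul]⟩

/-- On a nondegenerate interval, the velocity of a mate `γ + lam n` is computed by the
product rule. -/
theorem RegularMates.deriv_eq {I : Set ℝ} (hU : UniqueDiffOn ℝ I) {γ γb : ℝ → ℝ × ℝ}
    {lam : ℝ → ℝ} (hγ : ContDiff ℝ (⊤ : ℕ∞) γ)
    (h : RegularMates I γ γb (fun s => Jrot (deriv γ s)) lam) {s : ℝ} (hs : s ∈ I) :
    deriv γb s = deriv γ s +
      (lam s • Jrot (deriv (deriv γ) s) + deriv lam s • Jrot (deriv γ s)) := by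
  obtain ⟨hγb, hlam, -, -, heq⟩ := h
  have hγ' : ContDiff ℝ 1 (deriv γ) :=
    ((contDiff_infty_iff_deriv.1 hγ).2).of_le (by exact_mod_cast le_top)
  have d1 := ((hγ.differentiable (by simp)) s).hasDerivAt
  have d2 := ((hγ'.differentiable (by simp)) s).hasDerivAt
  have dl := ((hlam.differentiable (by simp)) s).hasDerivAt
  have db := ((hγb.differentiable (by simp)) s).hasDerivAt
  have d := d1.add (dl.smul d2.jrot)
  exact (hU s hs).eq_deriv I db.hasDerivWithinAt (d.hasDerivWithinAt.congr heq (heq s hs))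

theorem dot_deriv_deriv_eq_zero {I : Set ℝ} (hU : UniqueDiffOn ℝ I) {γ : ℝ → ℝ × ℝ}
    (hγ : ContDiff ℝ (⊤ : ℕ∞) γ) (harc : ∀ s ∈ I, dot (deriv γ s) (deriv γ s) = 1)
    {s : ℝ} (hs : s ∈ I) : dot (deriv (deriv γ) s) (deriv γ s) = 0 := by
  have hγ' : ContDiff ℝ 1 (deriv γ) :=
    ((contDiff_infty_iff_deriv.1 hγ).2).of_le (by exact_mod_cast le_top)
  have d := ((hγ'.differentiable (by simp)) s).hasDerivAt.dot_self
  have h0 := (hU s hs).eq_deriv I d.hasDerivWithinAt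
    ((hasDerivWithinAt_const s I (1 : ℝ)).congr harc (harc s hs))
  linarith

theorem deriv_lam_eq_zero_and_one_sub_ne_zero {I : Set ℝ} (hU : UniqueDiffOn ℝ I)
    {γ γb : ℝ → ℝ × ℝ} {lam : ℝ → ℝ} (hγ : ContDiff ℝ (⊤ : ℕ∞) γ)
    (harc : ∀ s ∈ I, dot (deriv γ s) (deriv γ s) = 1)
    (h : RegularMates I γ γb (fun s => Jrot (deriv γ s)) lam)
    (hn : ∀ s ∈ I, Jrot (deriv γ s) = Jrot (utang γb s)) {s : ℝ} (hs : s ∈ I) :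
    deriv lam s = 0 ∧ 1 - lam s * dot (deriv (deriv γ) s) (Jrot (deriv γ s)) ≠ 0 := by
  have hd := h.deriv_eq hU hγ hs
  have h0 := dot_deriv_deriv_eq_zero hU hγ harc hs
  have h1 := harc s hs
  have ht : deriv γ s ≠ 0 := by
    intro ht
    simp [ht, dot] at h1
  obtain ⟨r, hr⟩ := exists_deriv_eq_smul_of_utang_eq (Jrot_injective (hn s hs)) ht
  have hr0 : r ≠ 0 := by
    rintro rfl
    exact h.2.2.1 s hs (by rw [hr, zero_smul])
  rw [hr] at hd
  have e1 := congrArg Prod.fst hd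
  have e2 := congrArg Prod.snd hd
  simp only [dot, Jrot, Prod.fst_add, Prod.snd_add, Prod.smul_fst, Prod.smul_snd,
    smul_eq_mul] at e1 e2 h0 h1 ⊢
  set a := (deriv γ s).1
  set b := (deriv γ s).2
  set p := (deriv (deriv γ) s).1
  set q := (deriv (deriv γ) s).2
  constructor
  · linear_combination b * e1 - a * e2 - lam s * h0 - deriv lam s * h1
  · intro hk
    apply hr0
    linear_combination a * e1 + b * e2 + hk + (1 - r) * h1

theorem Set.OrdConnected.uniqueDiffOn_of_nontrivial {I : Set ℝ} (hI : I.OrdConnected)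
    (hn : I.Nontrivial) : UniqueDiffOn ℝ I := by
  refine uniqueDiffOn_convex hI.convex ?_
  obtain ⟨a, ha, b, hb, hab⟩ := hn.exists_lt
  refine (Set.nonempty_Ioo.2 hab).mono (interior_maximal ?_ isOpen_Ioo)
  exact Set.Ioo_subset_Icc_self.trans (hI.out ha hb)

/-- At a single parameter value, a translate of `γ` along its normal is a mate. -/
theorem exists_regularMates_const_of_singleton (s : ℝ) {γ : ℝ → ℝ × ℝ}
    (hγ : ContDiff ℝ (⊤ : ℕ∞) γ) (harc : dot (deriv γ s) (deriv γ s) = 1)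
    {c : ℝ} (hc : c ≠ 0) :
    ∃ γb : ℝ → ℝ × ℝ, RegularMates {s} γ γb (fun s => Jrot (deriv γ s)) (fun _ => c) ∧
      ∀ x ∈ ({s} : Set ℝ), Jrot (deriv γ x) = Jrot (utang γb x) := by
  have hd : deriv (fun x => γ x + c • Jrot (deriv γ s)) s = deriv γ s := deriv_add_const _
  refine ⟨fun x => γ x + c • Jrot (deriv γ s), ⟨hγ.add contDiff_const, contDiff_const, ?_,
    notIdentZero_const _ hc, ?_⟩, ?_⟩
  · rintro x rfl
    rw [hd]
    intro h0
    simp [h0, dot] at harc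
  · rintro x rfl
    rfl
  · rintro x rfl
    rw [utang, hd, harc, Real.sqrt_one, inv_one, one_smul]

/-- **Corollary 3.4 (4).** For a unit-speed regular plane curve `γ` with curvature `κ`,
`γ` is an `(n, n̄)`-Bertrand regular curve (mate `γ̄ = γ + λ n` regular with
`n = n̄`, the normal of the mate) iff there are a regular mate and a nonzero constant `λ`
realizing it with `1 − λκ(s) ≠ 0` on `I`; the mate is then a parallel curve of `γ`. -/
theorem bertrand_n_nbar_iff_parallel
    (I : Set ℝ) (hI : I.OrdConnected)
    (γ : ℝ → ℝ × ℝ) (κ : ℝ → ℝ)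
    (hγ : ContDiff ℝ (⊤ : ℕ∞) γ)
    (harc : ∀ s ∈ I, dot (deriv γ s) (deriv γ s) = 1)
    (hκ : ∀ s ∈ I, κ s = dot (deriv (deriv γ) s) (Jrot (deriv γ s))) :
    (∃ (γb : ℝ → ℝ × ℝ) (lam : ℝ → ℝ),
        RegularMates I γ γb (fun s => Jrot (deriv γ s)) lam ∧
        (∀ s ∈ I, Jrot (deriv γ s) = Jrot (utang γb s))) ↔
    (∃ (γb : ℝ → ℝ × ℝ) (c : ℝ), c ≠ 0 ∧
        RegularMates I γ γb (fun s => Jrot (deriv γ s)) (fun _ => c) ∧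
        (∀ s ∈ I, Jrot (deriv γ s) = Jrot (utang γb s)) ∧
        (∀ s ∈ I, 1 - c * κ s ≠ 0)) := by
  constructor
  · rintro ⟨γb, lam, hm, hn⟩
    rcases I.subsingleton_or_nontrivial with hsub | hnt
    · rcases hsub.eq_empty_or_singleton with rfl | ⟨s, rfl⟩
      · exact ⟨γ, 1, one_ne_zero, ⟨hγ, contDiff_const, by simp, notIdentZero_const _ one_ne_zero,
          by simp⟩, by simp, by simp⟩
      · obtain ⟨c, hc, hck⟩ := exists_ne_zero_one_sub_mul_ne_zero (κ s)
        obtain ⟨γb, hm, hn⟩ := exists_regularMates_const_of_singleton s hγ (harc s rfl) hc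
        exact ⟨γb, c, hc, hm, hn, by rintro x rfl; exact hck⟩
    · have hU := hI.uniqueDiffOn_of_nontrivial hnt
      have key := fun s (hs : s ∈ I) =>
        deriv_lam_eq_zero_and_one_sub_ne_zero hU hγ harc hm hn hs
      obtain ⟨s₀, hs₀, hne⟩ := hm.2.2.2.1.exists_ne_zero hnt.nonempty
      have hconst : ∀ s ∈ I, lam s = lam s₀ := by
        intro s hs
        have hb := hI.convex.norm_image_sub_le_of_norm_hasDerivWithin_le (C := 0)
          (fun x _ => ((hm.2.1.differentiable (by simp)) x).hasDerivAt.hasDerivWithinAt)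
          (fun x hx => by rw [(key x hx).1, norm_zero]) hs₀ hs
        rwa [zero_mul, norm_le_zero_iff, sub_eq_zero] at hb
      refine ⟨γb, lam s₀, hne, ⟨hm.1, contDiff_const, hm.2.2.1, notIdentZero_const _ hne, ?_⟩,
        hn, ?_⟩
      · intro s hs
        rw [hm.2.2.2.2 s hs, hconst s hs]
      · intro s hs
        rw [hκ s hs, ← hconst s hs]
        exact (key s hs).2
  · rintro ⟨γb, c, -, hm, hn, -⟩
    exact ⟨γb, fun _ => c, hm, hn⟩
end
end

section
/- Let (γ,ν) : I → ℝ² × S¹ be a Legendre curve with curvature (ℓ,β) and let v, w̄ : I → S¹ be smooth maps. Then (γ,ν) is a (v,w̄)-Bertrand Legendre curve if and only if there exist smooth functions λ, θ, τ : I → ℝ with λ ≢ 0 such that v(t) = cos θ(t) ν(t) + sin θ(t) μ(t), the angle of w̄ in the frame of the mate is τ, and (β(t) sin θ(t) + λ̇(t)) cos τ(t) − (β(t) cos θ(t) + λ(t)(θ̇(t) + ℓ(t))) sin τ(t) = 0 for all t ∈ I. -/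
open Real

noncomputable section

/-- A Legendre curve on `I`: smooth `(γ,ν)` with `ν` unit and `γ̇·ν = 0` on `I`. -/
def IsLegendre (I : Set ℝ) (γ ν : ℝ → ℝ × ℝ) : Prop :=
  ContDiff ℝ (⊤ : ℕ∞) γ ∧ ContDiff ℝ (⊤ : ℕ∞) ν ∧ (∀ t ∈ I, dot (ν t) (ν t) = 1) ∧
  (∀ t ∈ I, dot (deriv γ t) (ν t) = 0)

/-- The first component `ℓ = ν̇·μ` of the Legendre curvature, with `μ = J∘ν`. -/
def legL (ν : ℝ → ℝ × ℝ) (t : ℝ) : ℝ := dot (deriv ν t) (Jrot (ν t))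

/-- The second component `β = γ̇·μ` of the Legendre curvature, with `μ = J∘ν`. -/
def legB (γ ν : ℝ → ℝ × ℝ) (t : ℝ) : ℝ := dot (deriv γ t) (Jrot (ν t))

theorem HasDerivAt.dot {f g : ℝ → ℝ × ℝ} {f' g' : ℝ × ℝ} {t : ℝ}
    (hf : HasDerivAt f f' t) (hg : HasDerivAt g g' t) :
    HasDerivAt (fun s => _root_.dot (f s) (g s)) (_root_.dot f' (g t) + _root_.dot (f t) g') t := by
  have hf1 : HasDerivAt (fun s => (f s).1) f'.1 t :=
    (hasFDerivAt_fst (𝕜 := ℝ) (p := f t)).comp_hasDerivAt t hf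
  have hf2 : HasDerivAt (fun s => (f s).2) f'.2 t :=
    (hasFDerivAt_snd (𝕜 := ℝ) (p := f t)).comp_hasDerivAt t hf
  have hg1 : HasDerivAt (fun s => (g s).1) g'.1 t :=
    (hasFDerivAt_fst (𝕜 := ℝ) (p := g t)).comp_hasDerivAt t hg
  have hg2 : HasDerivAt (fun s => (g s).2) g'.2 t :=
    (hasFDerivAt_snd (𝕜 := ℝ) (p := g t)).comp_hasDerivAt t hg
  refine ((hf1.mul hg1).add (hf2.mul hg2)).congr_deriv ?_
  simp only [_root_.dot]
  ring

theorem HasDerivAt.Jrot {f : ℝ → ℝ × ℝ} {f' : ℝ × ℝ} {t : ℝ} (hf : HasDerivAt f f' t) :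
    HasDerivAt (fun s => _root_.Jrot (f s)) (_root_.Jrot f') t := by
  have hf1 : HasDerivAt (fun s => (f s).1) f'.1 t :=
    (hasFDerivAt_fst (𝕜 := ℝ) (p := f t)).comp_hasDerivAt t hf
  have hf2 : HasDerivAt (fun s => (f s).2) f'.2 t :=
    (hasFDerivAt_snd (𝕜 := ℝ) (p := f t)).comp_hasDerivAt t hf
  exact hf2.neg.prodMk hf1

theorem ContDiff.dot {n : WithTop ℕ∞} {f g : ℝ → ℝ × ℝ} (hf : ContDiff ℝ n f)
    (hg : ContDiff ℝ n g) : ContDiff ℝ n fun s => _root_.dot (f s) (g s) :=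
  (hf.fst.mul hg.fst).add (hf.snd.mul hg.snd)

theorem ContDiff.Jrot {n : WithTop ℕ∞} {f : ℝ → ℝ × ℝ} (hf : ContDiff ℝ n f) :
    ContDiff ℝ n fun s => _root_.Jrot (f s) :=
  hf.snd.neg.prodMk hf.fst

/-- The vector obtained by rotating `a` by the angle `θ`. -/
def rotate (θ : ℝ) (a : ℝ × ℝ) : ℝ × ℝ := cos θ • a + sin θ • Jrot a

theorem ContDiff.rotate {n : WithTop ℕ∞} {θ : ℝ → ℝ} {a : ℝ → ℝ × ℝ} (hθ : ContDiff ℝ n θ)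
    (ha : ContDiff ℝ n a) : ContDiff ℝ n fun t => _root_.rotate (θ t) (a t) :=
  (hθ.cos.smul ha).add (hθ.sin.smul ha.Jrot)

theorem rotate_rotate (α θ : ℝ) (a : ℝ × ℝ) : rotate α (rotate θ a) = rotate (θ + α) a := by
  ext <;> simp [rotate, Jrot, cos_add, sin_add] <;> ring

theorem dot_rotate_self (θ : ℝ) (a : ℝ × ℝ) : dot (rotate θ a) (rotate θ a) = dot a a := by
  simp only [rotate, dot, Jrot, Prod.fst_add, Prod.snd_add, Prod.smul_fst, Prod.smul_snd,
    smul_eq_mul]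
  linear_combination (a.1 ^ 2 + a.2 ^ 2) * sin_sq_add_cos_sq θ

theorem eq_of_dot_eq_one {a b : ℝ × ℝ} (ha : dot a a = 1) (hb : dot b b = 1)
    (h : dot a b = 1) : a = b := by
  simp only [dot] at *
  have key : (a.1 - b.1) ^ 2 + (a.2 - b.2) ^ 2 = 0 := by linear_combination ha + hb - 2 * h
  ext <;> nlinarith [sq_nonneg (a.1 - b.1), sq_nonneg (a.2 - b.2)]

theorem exists_rotate_eq {a b : ℝ × ℝ} (ha : dot a a = 1) (hb : dot b b = 1) :
    ∃ θ, b = rotate θ a := by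
  simp only [dot] at ha hb
  set z : ℂ := ⟨a.1 * b.1 + a.2 * b.2, a.1 * b.2 - a.2 * b.1⟩ with hz
  have hn : ‖z‖ = 1 := by
    rw [Complex.norm_def, Complex.normSq_apply, Real.sqrt_eq_one]
    linear_combination (b.1 * b.1 + b.2 * b.2) * ha + hb
  have hc : cos z.arg = a.1 * b.1 + a.2 * b.2 := by
    have := Complex.norm_mul_cos_arg z
    rwa [hn, one_mul] at this
  have hs : sin z.arg = a.1 * b.2 - a.2 * b.1 := by
    have := Complex.norm_mul_sin_arg z
    rwa [hn, one_mul] at this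
  refine ⟨z.arg, ?_⟩
  ext
  · simp only [rotate, Jrot, hc, hs, Prod.fst_add, Prod.smul_fst, smul_eq_mul]
    linear_combination -b.1 * ha
  · simp only [rotate, Jrot, hc, hs, Prod.snd_add, Prod.smul_snd, smul_eq_mul]
    linear_combination -b.2 * ha

theorem UniqueDiffOn.deriv_eq_of_eqOn {E : Type*} [NormedAddCommGroup E] [NormedSpace ℝ E]
    {I : Set ℝ} (hI : UniqueDiffOn ℝ I) {f g : ℝ → E} (hf : Differentiable ℝ f)
    (hg : Differentiable ℝ g) (h : Set.EqOn f g I) {t : ℝ} (ht : t ∈ I) :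
    deriv f t = deriv g t := by
  rw [← (hf t).derivWithin (hI t ht), ← (hg t).derivWithin (hI t ht)]
  exact derivWithin_congr h (h ht)

theorem deriv_eq_legL_smul_Jrot {I : Set ℝ} (hI : UniqueDiffOn ℝ I) {a : ℝ → ℝ × ℝ}
    (ha : Differentiable ℝ a) (hu : ∀ t ∈ I, dot (a t) (a t) = 1) {t : ℝ} (ht : t ∈ I) :
    deriv a t = legL a t • Jrot (a t) := by
  have hd : HasDerivAt (fun s => dot (a s) (a s)) _ t := (ha t).hasDerivAt.dot (ha t).hasDerivAt
  have h0 := hI.deriv_eq_of_eqOn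
    (fun s => ((ha s).hasDerivAt.dot (ha s).hasDerivAt).differentiableAt)
    (differentiable_const (1 : ℝ)) hu ht
  rw [hd.deriv, deriv_const] at h0
  have h1 := hu t ht
  simp only [dot] at h0 h1
  ext
  · simp only [legL, dot, Jrot, Prod.smul_fst, smul_eq_mul]
    linear_combination (-(deriv a t).1) * h1 + (a t).1 / 2 * h0
  · simp only [legL, dot, Jrot, Prod.smul_snd, smul_eq_mul]
    linear_combination (-(deriv a t).2) * h1 + (a t).2 / 2 * h0

theorem HasDerivAt.rotate {θ : ℝ → ℝ} {a : ℝ → ℝ × ℝ} {θ' l t : ℝ} (hθ : HasDerivAt θ θ' t)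
    (ha : HasDerivAt a (l • _root_.Jrot (a t)) t) :
    HasDerivAt (fun s => _root_.rotate (θ s) (a s))
      ((θ' + l) • _root_.Jrot (_root_.rotate (θ t) (a t))) t := by
  refine ((hθ.cos.smul ha).add (hθ.sin.smul ha.Jrot)).congr_deriv ?_
  ext <;> simp [_root_.rotate, _root_.Jrot] <;> ring

theorem contDiff_primitive {f : ℝ → ℝ} (hf : ContDiff ℝ (⊤ : ℕ∞) f) (t₀ : ℝ) :
    ContDiff ℝ (⊤ : ℕ∞) fun t => ∫ s in t₀..t, f s := by
  have h t : HasDerivAt (fun t => ∫ s in t₀..t, f s) (f t) t :=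
    hf.continuous.integral_hasStrictDerivAt t₀ t |>.hasDerivAt
  rw [contDiff_infty_iff_deriv]
  refine ⟨fun t => (h t).differentiableAt, ?_⟩
  rwa [show deriv (fun t => ∫ s in t₀..t, f s) = f from funext fun t => (h t).deriv]

theorem contDiff_legL {a : ℝ → ℝ × ℝ} (ha : ContDiff ℝ (⊤ : ℕ∞) a) :
    ContDiff ℝ (⊤ : ℕ∞) (legL a) :=
  (contDiff_infty_iff_deriv.1 ha).2.dot ha.Jrot

/-- Two smooth fields that are unit on an interval differ there by a smooth angle function. -/
theorem exists_contDiff_angle {I : Set ℝ} (hI : Convex ℝ I) (hU : UniqueDiffOn ℝ I) {t₀ : ℝ}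
    (ht₀ : t₀ ∈ I) {a b : ℝ → ℝ × ℝ} (ha : ContDiff ℝ (⊤ : ℕ∞) a) (hb : ContDiff ℝ (⊤ : ℕ∞) b)
    (hau : ∀ t ∈ I, dot (a t) (a t) = 1) (hbu : ∀ t ∈ I, dot (b t) (b t) = 1) :
    ∃ θ : ℝ → ℝ, ContDiff ℝ (⊤ : ℕ∞) θ ∧ ∀ t ∈ I, b t = rotate (θ t) (a t) := by
  obtain ⟨θ₀, hθ₀⟩ := exists_rotate_eq (hau t₀ ht₀) (hbu t₀ ht₀)
  have hf : ContDiff ℝ (⊤ : ℕ∞) fun s => legL b s - legL a s :=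
    (contDiff_legL hb).sub (contDiff_legL ha)
  set θ : ℝ → ℝ := fun t => θ₀ + ∫ s in t₀..t, (legL b s - legL a s) with hθ
  have hθs : ContDiff ℝ (⊤ : ℕ∞) θ := contDiff_const.add (contDiff_primitive hf t₀)
  have hθd t : HasDerivAt θ (legL b t - legL a t) t :=
    (hf.continuous.integral_hasStrictDerivAt t₀ t).hasDerivAt.const_add θ₀
  have had := ha.differentiable (by simp)
  have hbd := hb.differentiable (by simp)
  have hF : ∀ t ∈ I, HasDerivWithinAt (fun s => dot (b s) (rotate (θ s) (a s))) 0 I t := by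
    intro t ht
    have ha' := (had t).hasDerivAt
    have hb' := (hbd t).hasDerivAt
    rw [deriv_eq_legL_smul_Jrot hU had hau ht] at ha'
    rw [deriv_eq_legL_smul_Jrot hU hbd hbu ht] at hb'
    refine ((hb'.dot ((hθd t).rotate ha')).congr_deriv ?_).hasDerivWithinAt
    simp only [dot, Jrot, Prod.smul_fst, Prod.smul_snd, smul_eq_mul]
    ring
  refine ⟨θ, hθs, fun t ht => eq_of_dot_eq_one (hbu t ht) ?_ ?_⟩
  · rw [dot_rotate_self, hau t ht]
  · have hc := hI.is_const_of_fderivWithin_eq_zero (𝕜 := ℝ)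
      (fun s hs => (hF s hs).differentiableWithinAt)
      (fun s hs => by
        rw [(hF s hs).hasFDerivWithinAt.fderivWithin (hU s hs)]
        ext
        simp) ht ht₀
    have h0 : θ t₀ = θ₀ := by simp [hθ]
    simp only [h0, ← hθ₀] at hc
    rw [hc, hbu t₀ ht₀]

theorem IsLegendre.deriv_eq {I : Set ℝ} {γ ν : ℝ → ℝ × ℝ} (h : IsLegendre I γ ν) {t : ℝ}
    (ht : t ∈ I) : deriv γ t = legB γ ν t • Jrot (ν t) := by
  have h1 := h.2.2.1 t ht
  have h0 := h.2.2.2 t ht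
  simp only [dot] at h0 h1
  ext
  · simp only [legB, dot, Jrot, Prod.smul_fst, smul_eq_mul]
    linear_combination (-(deriv γ t).1) * h1 + (ν t).1 * h0
  · simp only [legB, dot, Jrot, Prod.smul_snd, smul_eq_mul]
    linear_combination (-(deriv γ t).2) * h1 + (ν t).2 * h0

theorem IsLegendre.dot_deriv_add_smul {I : Set ℝ} (hU : UniqueDiffOn ℝ I) {γ ν v : ℝ → ℝ × ℝ}
    (hL : IsLegendre I γ ν) {lam θ : ℝ → ℝ} (hv : Differentiable ℝ v)
    (hlam : Differentiable ℝ lam) (hθ : Differentiable ℝ θ)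
    (hvθ : ∀ t ∈ I, v t = rotate (θ t) (ν t)) {t : ℝ} (ht : t ∈ I) (τ : ℝ) :
    dot (deriv (fun s => γ s + lam s • v s) t) (rotate (θ t - τ) (ν t)) =
      (legB γ ν t * sin (θ t) + deriv lam t) * cos τ
        - (legB γ ν t * cos (θ t) + lam t * (deriv θ t + legL ν t)) * sin τ := by
  have hγ := (hL.1.differentiable (by simp) t).hasDerivAt
  have hνd := hL.2.1.differentiable (by simp)
  have hν := (hνd t).hasDerivAt
  rw [hL.deriv_eq ht] at hγ
  rw [deriv_eq_legL_smul_Jrot hU hνd hL.2.2.1 ht] at hν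
  have hv' := (hv t).hasDerivAt
  have hr : Differentiable ℝ fun s => rotate (θ s) (ν s) := fun s =>
    (((hθ s).hasDerivAt.cos.smul (hνd s).hasDerivAt).add
      ((hθ s).hasDerivAt.sin.smul (hνd s).hasDerivAt.Jrot)).differentiableAt
  rw [hU.deriv_eq_of_eqOn hv hr hvθ ht, ((hθ t).hasDerivAt.rotate hν).deriv] at hv'
  have hd : HasDerivAt (fun s => γ s + lam s • v s) _ t :=
    hγ.add ((hlam t).hasDerivAt.smul hv')
  rw [hd.deriv, hvθ t ht]
  have h1 := hL.2.2.1 t ht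
  have e1 : dot (Jrot (ν t)) (rotate (θ t - τ) (ν t)) = sin (θ t - τ) := by
    simp only [dot, rotate, Jrot, Prod.fst_add, Prod.snd_add, Prod.smul_fst, Prod.smul_snd,
      smul_eq_mul] at h1 ⊢
    linear_combination sin (θ t - τ) * h1
  have e2 : dot (rotate (θ t) (ν t)) (rotate (θ t - τ) (ν t)) = cos τ := by
    have h2 : cos τ = cos (θ t) * cos (θ t - τ) + sin (θ t) * sin (θ t - τ) := by
      rw [← cos_sub]; ring_nf
    rw [h2]
    simp only [dot, rotate, Jrot, Prod.fst_add, Prod.snd_add, Prod.smul_fst, Prod.smul_snd,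
      smul_eq_mul] at h1 ⊢
    linear_combination
      (cos (θ t) * cos (θ t - τ) + sin (θ t) * sin (θ t - τ)) * h1
  have e3 : dot (Jrot (rotate (θ t) (ν t))) (rotate (θ t - τ) (ν t)) = -sin τ := by
    have h2 : sin τ = sin (θ t) * cos (θ t - τ) - cos (θ t) * sin (θ t - τ) := by
      rw [← sin_sub]; ring_nf
    rw [h2]
    simp only [dot, rotate, Jrot, Prod.fst_add, Prod.snd_add, Prod.smul_fst, Prod.smul_snd,
      smul_eq_mul] at h1 ⊢
    linear_combination
      (cos (θ t) * sin (θ t - τ) - sin (θ t) * cos (θ t - τ)) * h1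
  rw [sin_sub] at e1
  simp only [dot, Prod.fst_add, Prod.snd_add, Prod.smul_fst, Prod.smul_snd, smul_eq_mul]
    at e1 e2 e3 ⊢
  linear_combination legB γ ν t * e1 + deriv lam t * e2 +
    lam t * (deriv θ t + legL ν t) * e3

theorem exists_mul_cos_sub_mul_sin_eq_zero (a b : ℝ) : ∃ τ, a * cos τ - b * sin τ = 0 := by
  refine ⟨Complex.arg ⟨b, a⟩, ?_⟩
  have hc := Complex.norm_mul_cos_arg ⟨b, a⟩
  have hs := Complex.norm_mul_sin_arg ⟨b, a⟩
  simp only at hc hs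
  linear_combination cos (Complex.arg ⟨b, a⟩) * -hs + sin (Complex.arg ⟨b, a⟩) * hc

/-- **Theorem 4.2.** Let `(γ,ν)` be a Legendre curve with curvature `(ℓ,β)` and
`v, w̄ : I → S¹` smooth. Then `(γ,ν)` is a `(v,w̄)`-Bertrand Legendre curve
(there is a Legendre mate `(γ̄,ν̄)` and a smooth `λ ≢ 0` with `γ̄ = γ + λ v`, `v = w̄`)
iff there are smooth `λ, θ, τ` with `λ ≢ 0` such that `v = cos θ ν + sin θ μ`,
`w̄` has angle `τ` in the frame of the mate `ν̄ = cos(θ−τ)ν + sin(θ−τ)μ`, and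
`(β sin θ + λ̇) cos τ − (β cos θ + λ(θ̇ + ℓ)) sin τ = 0` on `I`. -/
theorem bertrand_legendre_characterization
    (I : Set ℝ) (hI : I.OrdConnected)
    (γ ν v w : ℝ → ℝ × ℝ)
    (hL : IsLegendre I γ ν)
    (hv : ContDiff ℝ (⊤ : ℕ∞) v) (hw : ContDiff ℝ (⊤ : ℕ∞) w)
    (hvS : ∀ t ∈ I, dot (v t) (v t) = 1)
    (hwS : ∀ t ∈ I, dot (w t) (w t) = 1) :
    (∃ (γb νb : ℝ → ℝ × ℝ) (lam : ℝ → ℝ),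
        IsLegendre I γb νb ∧ ContDiff ℝ (⊤ : ℕ∞) lam ∧ NotIdentZero I lam ∧
        (∀ t ∈ I, γb t = γ t + lam t • v t) ∧
        (∀ t ∈ I, v t = w t)) ↔
    (∃ lam θ τ : ℝ → ℝ,
        ContDiff ℝ (⊤ : ℕ∞) lam ∧ ContDiff ℝ (⊤ : ℕ∞) θ ∧ ContDiff ℝ (⊤ : ℕ∞) τ ∧
        NotIdentZero I lam ∧
        (∀ t ∈ I, v t = cos (θ t) • ν t + sin (θ t) • Jrot (ν t)) ∧
        (∀ t ∈ I, w t =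
          cos (τ t) • (cos (θ t - τ t) • ν t + sin (θ t - τ t) • Jrot (ν t)) +
          sin (τ t) • Jrot (cos (θ t - τ t) • ν t + sin (θ t - τ t) • Jrot (ν t))) ∧
        (∀ t ∈ I, (legB γ ν t * sin (θ t) + deriv lam t) * cos (τ t)
            - (legB γ ν t * cos (θ t) + lam t * (deriv θ t + legL ν t)) * sin (τ t) = 0)) := by
  change _ ↔ ∃ lam θ τ : ℝ → ℝ,
        ContDiff ℝ (⊤ : ℕ∞) lam ∧ ContDiff ℝ (⊤ : ℕ∞) θ ∧ ContDiff ℝ (⊤ : ℕ∞) τ ∧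
        NotIdentZero I lam ∧
        (∀ t ∈ I, v t = rotate (θ t) (ν t)) ∧
        (∀ t ∈ I, w t = rotate (τ t) (rotate (θ t - τ t) (ν t))) ∧
        (∀ t ∈ I, (legB γ ν t * sin (θ t) + deriv lam t) * cos (τ t)
            - (legB γ ν t * cos (θ t) + lam t * (deriv θ t + legL ν t)) * sin (τ t) = 0)
  simp only [rotate_rotate, sub_add_cancel]
  rcases I.eq_empty_or_nonempty with rfl | ⟨t₀, ht₀⟩
  · exact ⟨fun ⟨_, _, lam, _, hlam, _⟩ => ⟨lam, 0, 0, hlam, contDiff_const, contDiff_const,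
      by simp [NotIdentZero]⟩, fun ⟨lam, _, _, hlam, _⟩ => ⟨γ, ν, lam, hL, hlam,
      by simp [NotIdentZero]⟩⟩
  rcases I.subsingleton_or_nontrivial with hs | hn
  · obtain rfl : I = {t₀} := hs.eq_singleton_of_mem ht₀
    simp only [Set.mem_singleton_iff, forall_eq] at *
    constructor
    · rintro ⟨_, _, lam, _, hlam, hne, _, hvw⟩
      obtain ⟨θ, hθ⟩ := exists_rotate_eq (hL.2.2.1 t₀ rfl) hvS
      obtain ⟨τ, hτ⟩ := exists_mul_cos_sub_mul_sin_eq_zero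
        (legB γ ν t₀ * sin θ + deriv lam t₀) (legB γ ν t₀ * cos θ + lam t₀ * (0 + legL ν t₀))
      refine ⟨lam, fun _ => θ, fun _ => τ, hlam, contDiff_const, contDiff_const, hne, hθ,
        hvw ▸ hθ, ?_⟩
      simpa using hτ
    · rintro ⟨lam, θ, τ, hlam, -, -, hne, hvθ, hwθ, -⟩
      refine ⟨fun _ => γ t₀ + lam t₀ • v t₀, fun _ => v t₀, lam,
        ⟨contDiff_const, contDiff_const, ?_, ?_⟩, hlam, hne, rfl, hvθ.trans hwθ.symm⟩
      · simpa using hvS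
      · simp [dot]
  have hC : Convex ℝ I := hI.convex
  have hU : UniqueDiffOn ℝ I := uniqueDiffOn_convex hC (hC.nontrivial_iff_nonempty_interior.1 hn)
  have hvd := hv.differentiable (by simp)
  have hγd := hL.1.differentiable (by simp)
  constructor
  · rintro ⟨γb, νb, lam, hLb, hlam, hne, hγb, hvw⟩
    have hlamd := hlam.differentiable (by simp)
    obtain ⟨θ, hθ, hvθ⟩ := exists_contDiff_angle hC hU ht₀ hL.2.1 hv hL.2.2.1 hvS
    obtain ⟨φ, hφ, hνφ⟩ := exists_contDiff_angle hC hU ht₀ hL.2.1 hLb.2.1 hL.2.2.1 hLb.2.2.1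
    refine ⟨lam, θ, fun t => θ t - φ t, hlam, hθ, hθ.sub hφ, hne, hvθ,
      fun t ht => hvw t ht ▸ hvθ t ht, fun t ht => ?_⟩
    have hd : deriv γb t = deriv (fun s => γ s + lam s • v s) t :=
      hU.deriv_eq_of_eqOn (hLb.1.differentiable (by simp)) (hγd.add (hlamd.smul hvd)) hγb ht
    rw [← hL.dot_deriv_add_smul hU hvd hlamd (hθ.differentiable (by simp)) hvθ ht,
      sub_sub_cancel, ← hνφ t ht, ← hd]
    exact hLb.2.2.2 t ht
  · rintro ⟨lam, θ, τ, hlam, hθ, hτ, hne, hvθ, hwθ, h⟩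
    refine ⟨fun t => γ t + lam t • v t, fun t => rotate (θ t - τ t) (ν t), lam,
      ⟨hL.1.add (hlam.smul hv), (hθ.sub hτ).rotate hL.2.1, fun t ht => ?_, fun t ht => ?_⟩,
      hlam, hne, fun _ _ => rfl, fun t ht => (hvθ t ht).trans (hwθ t ht).symm⟩
    · rw [dot_rotate_self, hL.2.2.1 t ht]
    · rw [hL.dot_deriv_add_smul hU hvd (hlam.differentiable (by simp))
        (hθ.differentiable (by simp)) hvθ ht]
      exact h t ht
end
end
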